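/- Let 1 ≤ p, q ≤ r with p ≠ q and let s, t ∈ 𝔞. (a) If [EUL_{p,q}(s), EUR_{p,q}(t)] = 0, then s·η(t) = t·η(s); in particular, if moreover η(t) = t then s·t = t·η(s). (b) If [EUL_{p,q}(s), EBL_{p,q}(t)] = 0, then η(s)·t = η(t)·s; in particular, if moreover η(t) = t then η(s)·t = t·s. -/

import Mathlib

namespace GIMPaper

/-- The paper's `E_{i,j}(a)`: the `(2r+1) × (2r+1)` matrix over `A` whose entry at the
(1-based) position `(i, j)` is `a` and all of whose other entries are `0`. -/
def E (A : Type*) [Ring A] (r i j : ℕ) (a : A) :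
    Matrix (Fin (2 * r + 1)) (Fin (2 * r + 1)) A :=
  fun x y => if (x : ℕ) + 1 = i ∧ (y : ℕ) + 1 = j then a else 0

/-- `Evert_k(a) = E_{k,r+1}(a) + E_{r+1,2r+2-k}(-η a)`. -/
def Evert (A : Type*) [Ring A] (r : ℕ) (η : A → A) (k : ℕ) (a : A) :
    Matrix (Fin (2 * r + 1)) (Fin (2 * r + 1)) A :=
  E A r k (r + 1) a + E A r (r + 1) (2 * r + 2 - k) (-η a)

/-- `Ehort_k(a) = E_{r+1,k}(a) + E_{2r+2-k,r+1}(-η a)`. -/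
def Ehort (A : Type*) [Ring A] (r : ℕ) (η : A → A) (k : ℕ) (a : A) :
    Matrix (Fin (2 * r + 1)) (Fin (2 * r + 1)) A :=
  E A r (r + 1) k a + E A r (2 * r + 2 - k) (r + 1) (-η a)

/-- `EUL_{p,q}(a) = E_{p,q}(a) + E_{2r+2-q,2r+2-p}(-η a)`. -/
def EUL (A : Type*) [Ring A] (r : ℕ) (η : A → A) (p q : ℕ) (a : A) :
    Matrix (Fin (2 * r + 1)) (Fin (2 * r + 1)) A :=
  E A r p q a + E A r (2 * r + 2 - q) (2 * r + 2 - p) (-η a)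

/-- `EUR_{p,q}(a) = E_{p,2r+2-q}(a) + E_{q,2r+2-p}(-η a)`. -/
def EUR (A : Type*) [Ring A] (r : ℕ) (η : A → A) (p q : ℕ) (a : A) :
    Matrix (Fin (2 * r + 1)) (Fin (2 * r + 1)) A :=
  E A r p (2 * r + 2 - q) a + E A r q (2 * r + 2 - p) (-η a)

/-- `EBL_{p,q}(a) = E_{2r+2-p,q}(a) + E_{2r+2-q,p}(-η a)`. -/
def EBL (A : Type*) [Ring A] (r : ℕ) (η : A → A) (p q : ℕ) (a : A) :
    Matrix (Fin (2 * r + 1)) (Fin (2 * r + 1)) A :=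
  E A r (2 * r + 2 - p) q a + E A r (2 * r + 2 - q) p (-η a)

end GIMPaper

open GIMPaper

theorem E_mul_ne (A : Type*) [Ring A] (r i j k l : ℕ) (a b : A) (h : j ≠ k) :
    E A r i j a * E A r k l b = 0 := by
  ext x y
  rw [Matrix.mul_apply]
  apply Finset.sum_eq_zero
  intro z _
  unfold E
  by_cases h1 : (z : ℕ) + 1 = j
  · have h2 : (z : ℕ) + 1 ≠ k := by omega
    simp [h2]
  · simp [h1]

theorem E_mul_same (A : Type*) [Ring A] (r i j l : ℕ) (a b : A) (h1 : 1 ≤ j)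
    (h2 : j ≤ 2 * r + 1) :
    E A r i j a * E A r j l b = E A r i l (a * b) := by
  ext x y
  rw [Matrix.mul_apply, Finset.sum_eq_single (⟨j - 1, by omega⟩ : Fin (2 * r + 1))]
  · have h3 : j - 1 + 1 = j := by omega
    unfold E
    by_cases hx : (x : ℕ) + 1 = i <;> by_cases hy : (y : ℕ) + 1 = l <;> simp [h3, hx, hy]
  · intro z _ hz
    have h3 : (z : ℕ) + 1 ≠ j := fun h => hz (Fin.ext (by simp; omega))
    simp [E, h3]
  · simp

theorem E_sub_eq (A : Type*) [Ring A] (r i j : ℕ) (a b : A) (hi1 : 1 ≤ i)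
    (hi2 : i ≤ 2 * r + 1) (hj1 : 1 ≤ j) (hj2 : j ≤ 2 * r + 1)
    (h : E A r i j a - E A r i j b = 0) : a = b := by
  have h3 := congrFun (congrFun h ⟨i - 1, by omega⟩) ⟨j - 1, by omega⟩
  have hi : i - 1 + 1 = i := by omega
  have hj : j - 1 + 1 = j := by omega
  simp only [Matrix.sub_apply, E, hi, hj] at h3
  simpa [sub_eq_zero] using h3

theorem stmt_18
    (r : ℕ) (hr : 3 ≤ r) (A : Type*) [Ring A] [Algebra ℂ A]
    (η : A → A)
    (hη_add : ∀ a b : A, η (a + b) = η a + η b)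
    (hη_smul : ∀ (c : ℂ) (a : A), η (c • a) = c • η a)
    (hη_mul : ∀ a b : A, η (a * b) = η b * η a)
    (hη_one : η (1 : A) = 1)
    (hη_invol : ∀ a : A, η (η a) = a)
    (p q : ℕ) (hp1 : 1 ≤ p) (hpr : p ≤ r) (hq1 : 1 ≤ q) (hqr : q ≤ r)
    (hpq : p ≠ q) (s t : A) :
    ((EUL A r η p q s * EUR A r η p q t - EUR A r η p q t * EUL A r η p q s = 0)
      → s * η t = t * η s ∧ (η t = t → s * t = t * η s))
    ∧ ((EUL A r η p q s * EBL A r η p q t - EBL A r η p q t * EUL A r η p q s = 0)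
      → η s * t = η t * s ∧ (η t = t → η s * t = t * s)) := by
  constructor
  · intro h
    have key : s * η t = t * η s := by
      unfold EUL EUR at h
      simp only [add_mul, mul_add] at h
      rw [E_mul_ne A r p q p _ _ _ (by omega),
        E_mul_same A r p q _ _ _ (by omega) (by omega),
        E_mul_ne A r _ (2 * r + 2 - p) p _ _ _ (by omega),
        E_mul_ne A r _ (2 * r + 2 - p) q _ _ _ (by omega),
        E_mul_ne A r p (2 * r + 2 - q) p _ _ _ (by omega),
        E_mul_same A r p (2 * r + 2 - q) _ _ _ (by omega) (by omega),
        E_mul_ne A r q (2 * r + 2 - p) p _ _ _ (by omega),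
        E_mul_ne A r q (2 * r + 2 - p) (2 * r + 2 - q) _ _ _ (by omega)] at h
      simp only [add_zero, zero_add] at h
      have h' := E_sub_eq A r _ _ _ _ (by omega) (by omega) (by omega) (by omega) h
      simpa using h'
    exact ⟨key, fun ht => by rwa [ht] at key⟩
  · intro h
    have key : η s * t = η t * s := by
      unfold EUL EBL at h
      simp only [add_mul, mul_add] at h
      rw [E_mul_ne A r p q (2 * r + 2 - p) _ _ _ (by omega),
        E_mul_ne A r p q (2 * r + 2 - q) _ _ _ (by omega),
        E_mul_same A r _ (2 * r + 2 - p) _ _ _ (by omega) (by omega),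
        E_mul_ne A r _ (2 * r + 2 - p) (2 * r + 2 - q) _ _ _ (by omega),
        E_mul_ne A r _ q p _ _ _ (by omega),
        E_mul_ne A r _ q (2 * r + 2 - q) _ _ _ (by omega),
        E_mul_same A r _ p _ _ _ (by omega) (by omega),
        E_mul_ne A r _ p (2 * r + 2 - q) _ _ _ (by omega)] at h
      simp only [add_zero, zero_add] at h
      have h' := E_sub_eq A r _ _ _ _ (by omega) (by omega) (by omega) (by omega) h
      simpa using h'
    exact ⟨key, fun ht => by rwa [ht] at key⟩
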